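/- Let G be a strongly regular graph with parameters (1911, 270, 105, 27) containing an induced quadrangle x ~ u ~ y ~ v ~ x, and let W = {w : w ~ x, w ∉ {u, v}, w not adjacent to u, w not adjacent to v}. Then |W| ≠ 83. -/

import Mathlib

section

open Finset

namespace SimpleGraph

variable {α : Type*} [Fintype α] {H : SimpleGraph α} [DecidableRel H.Adj]

/-- If the non-isolated vertices have large degree then there are few isolated vertices. -/
theorem card_isolated_le (hcard : Fintype.card α = 83) (hne : ∃ w, H.degree w ≠ 0)
    (hdeg : ∀ w, H.degree w ≠ 0 → 28 ≤ H.degree w)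
    (hpsd : ∀ f : α → ℝ, 11 * ∑ i, f i * ∑ j ∈ H.neighborFinset i, f j ≤
      22 * ∑ i, f i ^ 2 + 5 * (∑ i, f i) ^ 2) :
    #{w | H.degree w = 0} ≤ 5 := by
  set b := #{w | H.degree w = 0} with hb
  set m := #{w | ¬ H.degree w = 0} with hm
  have hbm : b + m = 83 := by
    rw [hb, hm, card_filter_add_card_filter_not, card_univ, hcard]
  have hbm' : (m : ℝ) = 83 - b := by
    rw [eq_sub_iff_add_eq, add_comm]
    exact_mod_cast hbm
  have hm0 : (0 : ℝ) < m := by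
    obtain ⟨w, hw⟩ := hne
    exact_mod_cast card_pos.2 ⟨w, by simpa using hw⟩
  by_contra! hb5
  have hb6 : (6 : ℝ) ≤ b := by exact_mod_cast hb5
  set f : α → ℝ := fun i ↦ if H.degree i = 0 then -m else b with hf
  have h1 : ∑ i, f i = 0 := by
    simp only [hf, sum_ite, sum_const, nsmul_eq_mul, ← hb, ← hm]
    ring
  have h2 : ∑ i, f i ^ 2 = 83 * b * m := by
    simp only [hf, ite_pow, sum_ite, sum_const, nsmul_eq_mul, ← hb, ← hm]
    rw [hbm']
    ring
  have h3 : 28 * m * (b : ℝ) ^ 2 ≤ ∑ i, f i * ∑ j ∈ H.neighborFinset i, f j := by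
    have : ∑ i, (if H.degree i = 0 then 0 else 28 * (b : ℝ) ^ 2) = 28 * m * (b : ℝ) ^ 2 := by
      simp only [sum_ite, sum_const, nsmul_eq_mul, ← hm]
      ring
    rw [← this]
    refine sum_le_sum fun i _ ↦ ?_
    split_ifs with hi
    · have : H.neighborFinset i = ∅ := by
        rwa [← card_eq_zero, card_neighborFinset_eq_degree]
      simp [this]
    · have h4 : ∑ j ∈ H.neighborFinset i, f j = H.degree i * b := by
        rw [← card_neighborFinset_eq_degree, ← nsmul_eq_mul, ← sum_const]
        refine sum_congr rfl fun j hj ↦ if_neg ?_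
        exact ((H.degree_pos_iff_exists_adj j).2 ⟨i, by simpa [adj_comm] using hj⟩).ne'
      have h5 : (28 : ℝ) ≤ H.degree i := by exact_mod_cast hdeg i hi
      rw [h4]
      simp only [hf, if_neg hi]
      nlinarith [sq_nonneg (b : ℝ)]
  have h6 := hpsd f
  rw [h1, h2] at h6
  have h7 : 0 < (b : ℝ) * m := by positivity
  nlinarith

/-- A vertex has few or almost all neighbours in the (independent) neighbourhood of a vertex. -/
theorem card_inter_neighborFinset_dichotomy [DecidableEq α]
    (hpsd : ∀ f : α → ℝ, 11 * ∑ i, f i * ∑ j ∈ H.neighborFinset i, f j ≤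
      22 * ∑ i, f i ^ 2 + 5 * (∑ i, f i) ^ 2)
    {P : Finset α} (hP : H.IsIndepSet P) {r : α} (hr : r ∉ P) :
    11 * (#(P ∩ H.neighborFinset r) * #(P \ H.neighborFinset r)) ≤ 54 * #P := by
  set N := P ∩ H.neighborFinset r with hN
  set M := P \ H.neighborFinset r with hM
  have hPNM : #P = #N + #M := (card_inter_add_card_sdiff _ _).symm
  have hdis : Disjoint N M := disjoint_sdiff_inter P _ |>.symm
  have hrN : r ∉ N := fun h ↦ hr (mem_inter.1 h).1
  have hrM : r ∉ M := fun h ↦ hr (mem_sdiff.1 h).1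
  rcases Nat.eq_zero_or_pos (#N * #M) with h0 | hpos
  · simp [h0]
  set d : ℝ := ((#N : ℕ) : ℝ)
  set e : ℝ := ((#M : ℕ) : ℝ)
  set c : ℝ := 11 * (d * e) / 27 with hc
  set f : α → ℝ := fun i ↦ (if i ∈ N then e else 0) + (if i ∈ M then -d else 0) +
    if i = r then c else 0 with hf
  have hsum (s : Finset α) : ∑ i ∈ s, f i =
      e * #(s ∩ N) - d * #(s ∩ M) + if r ∈ s then c else 0 := by
    simp only [hf, sum_add_distrib, sum_ite_mem, sum_ite_eq', sum_const, nsmul_eq_mul]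
    ring
  have hsum_mul (g : α → ℝ) : ∑ i, f i * g i = e * ∑ i ∈ N, g i - d * ∑ i ∈ M, g i + c * g r := by
    simp only [hf, add_mul, ite_mul, zero_mul, sum_add_distrib, sum_ite_mem, sum_ite_eq',
      univ_inter, mul_sum, mem_univ, if_true, neg_mul, sum_neg_distrib]
    ring
  have hindep {i j : α} (hi : i ∈ P) (hj : j ∈ P) : ¬ H.Adj i j := fun h ↦ hP hi hj h.ne h
  have hNP {i : α} (hi : i ∈ N) : i ∈ P := (mem_inter.1 hi).1
  have hMP {i : α} (hi : i ∈ M) : i ∈ P := (mem_sdiff.1 hi).1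
  have hempty {i : α} (hi : i ∈ P) :
      H.neighborFinset i ∩ N = ∅ ∧ H.neighborFinset i ∩ M = ∅ := by
    constructor <;> ext j <;> simp only [mem_inter, mem_neighborFinset, notMem_empty, iff_false]
    · exact fun h ↦ hindep hi (hNP h.2) h.1
    · exact fun h ↦ hindep hi (hMP h.2) h.1
  have h1 : ∑ i, f i = c := by
    rw [hsum]
    simp only [univ_inter, mem_univ, if_true]
    ring
  have h2 : ∑ i, f i ^ 2 = d * e * (d + e) + c ^ 2 := by
    simp only [pow_two]
    rw [hsum_mul]
    have hfN : ∑ i ∈ N, f i = d * e := by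
      rw [hsum, inter_self, disjoint_iff_inter_eq_empty.1 hdis, if_neg hrN]
      simp [d, mul_comm]
    have hfM : ∑ i ∈ M, f i = -(d * e) := by
      rw [hsum, inter_self, inter_comm, disjoint_iff_inter_eq_empty.1 hdis, if_neg hrM]
      simp [e]
    have hfr : f r = c := by simp [hf, hrN, hrM]
    rw [hfN, hfM, hfr]
    ring
  have h3 : ∑ i, f i * ∑ j ∈ H.neighborFinset i, f j = 2 * c * (d * e) := by
    rw [hsum_mul]
    have hfN : ∑ i ∈ N, ∑ j ∈ H.neighborFinset i, f j = d * c := by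
      rw [← nsmul_eq_mul, ← sum_const]
      refine sum_congr rfl fun i hi ↦ ?_
      obtain ⟨h4, h5⟩ := hempty (hNP hi)
      have : r ∈ H.neighborFinset i := by
        simpa [adj_comm] using (mem_inter.1 hi).2
      rw [hsum, h4, h5, if_pos this]
      simp
    have hfM : ∑ i ∈ M, ∑ j ∈ H.neighborFinset i, f j = 0 := by
      refine sum_eq_zero fun i hi ↦ ?_
      obtain ⟨h4, h5⟩ := hempty (hMP hi)
      have : r ∉ H.neighborFinset i := by
        simpa [adj_comm] using (mem_sdiff.1 hi).2
      rw [hsum, h4, h5, if_neg this]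
      simp
    have hfr : ∑ j ∈ H.neighborFinset r, f j = e * d := by
      have h4 : H.neighborFinset r ∩ N = N := inter_eq_right.2 inter_subset_right
      have h5 : H.neighborFinset r ∩ M = ∅ :=
        disjoint_iff_inter_eq_empty.1 disjoint_sdiff
      rw [hsum, h4, h5]
      simp [d]
    rw [hfN, hfM, hfr]
    ring
  have h6 := hpsd f
  rw [h1, h2, h3] at h6
  have hde : 0 < d * e := by simp only [d, e]; exact_mod_cast hpos
  have h7 : 11 * (d * e) ≤ 54 * (d + e) := by
    have h8 : d * e * (11 * (11 * (d * e))) ≤ d * e * (11 * (54 * (d + e))) := by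
      rw [hc] at h6
      nlinarith
    have := le_of_mul_le_mul_left h8 hde
    linarith
  rw [hPNM]
  simp only [d, e] at h7
  exact_mod_cast h7

theorem sum_card_inter_neighborFinset [DecidableEq α] (s t : Finset α) :
    ∑ i ∈ s, #(t ∩ H.neighborFinset i) = ∑ j ∈ t, #(s ∩ H.neighborFinset j) := by
  simp only [card_eq_sum_ones, ← filter_mem_eq_inter, sum_filter, mem_neighborFinset]
  rw [sum_comm]
  simp only [H.adj_comm]

/-- The bound given by the `±1` vector that is positive exactly on `X`. -/
theorem eleven_mul_sum_degree_le [DecidableEq α]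
    (hpsd : ∀ f : α → ℝ, 11 * ∑ i, f i * ∑ j ∈ H.neighborFinset i, f j ≤
      22 * ∑ i, f i ^ 2 + 5 * (∑ i, f i) ^ 2) (X : Finset α) :
    11 * (4 * ∑ i ∈ X, (#(X ∩ H.neighborFinset i) : ℝ) - 4 * ∑ i ∈ X, (H.degree i : ℝ) +
      ∑ i, (H.degree i : ℝ)) ≤
      22 * Fintype.card α + 5 * (2 * #X - Fintype.card α : ℝ) ^ 2 := by
  set f : α → ℝ := fun i ↦ 2 * (if i ∈ X then 1 else 0) - 1 with hf
  have hsum (s : Finset α) : ∑ i ∈ s, f i = 2 * #(X ∩ s) - #s := by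
    simp [hf, inter_comm, mul_comm]
  have hsum_mul (g : α → ℝ) : ∑ i, f i * g i = 2 * ∑ i ∈ X, g i - ∑ i, g i := by
    simp [hf, sub_mul, ← mul_sum]
  have h1 : ∑ i, f i ^ 2 = Fintype.card α := by
    rw [← card_univ, ← nsmul_one, ← sum_const]
    refine sum_congr rfl fun i _ ↦ ?_
    by_cases hi : i ∈ X <;> norm_num [hf, hi]
  have h2 : ∑ i, (#(X ∩ H.neighborFinset i) : ℝ) = ∑ i ∈ X, (H.degree i : ℝ) := by
    have := sum_card_inter_neighborFinset (H := H) univ X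
    simp only [univ_inter, card_neighborFinset_eq_degree] at this
    exact_mod_cast this
  have h3 := hpsd f
  simp only [hsum_mul, h1, hsum, card_neighborFinset_eq_degree, sum_sub_distrib, ← mul_sum,
    h2, inter_univ, card_univ] at h3
  linarith

/-- The semidefiniteness of `22 I + 5 J - 11 A` excludes edges: if there is one then `H` is
triangle-free, and the neighbourhoods of a non-isolated vertex `w` and of the vertices sharing
almost all neighbours of `w` give a bipartite subgraph that is too dense. -/
theorem eq_bot_of_card_eq_83 {α : Type*} [Fintype α] [DecidableEq α] (H : SimpleGraph α)
    [DecidableRel H.Adj] (hcard : Fintype.card α = 83) (hdeg : ∀ w, H.degree w ≤ 29)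
    (hunion : ∀ ⦃a b⦄, H.Adj a b → 57 ≤ #(H.neighborFinset a ∪ H.neighborFinset b))
    (hpsd : ∀ f : α → ℝ, 11 * ∑ i, f i * ∑ j ∈ H.neighborFinset i, f j ≤
      22 * ∑ i, f i ^ 2 + 5 * (∑ i, f i) ^ 2) :
    H = ⊥ := by
  by_contra hH
  have hsum {a b : α} (hab : H.Adj a b) : 57 + #(H.neighborFinset a ∩ H.neighborFinset b) ≤
      H.degree a + H.degree b := by
    have := card_union_add_card_inter (H.neighborFinset a) (H.neighborFinset b)
    simp only [card_neighborFinset_eq_degree] at this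
    have := hunion hab
    lia
  have hlow {a b : α} (hab : H.Adj a b) : 28 ≤ H.degree a := by
    have := hsum hab
    have := hdeg b
    lia
  have htri {a b c : α} (hab : H.Adj a b) (hac : H.Adj a c) (hbc : H.Adj b c) : False := by
    have hone {a b c : α} (hab : H.Adj a b) (hac : H.Adj a c) (hbc : H.Adj b c) :
        H.degree a = 29 ∧ H.neighborFinset a ∩ H.neighborFinset b = {c} := by
      have h1 : {c} ⊆ H.neighborFinset a ∩ H.neighborFinset b := by simp [hac, hbc]
      have h2 := card_le_card h1
      rw [card_singleton] at h2
      have h3 := hsum hab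
      have h4 := hdeg a
      have h5 := hdeg b
      refine ⟨by lia, (eq_of_subset_of_card_le h1 ?_).symm⟩
      rw [card_singleton]
      lia
    obtain ⟨ha, hiab⟩ := hone hab hac hbc
    obtain ⟨hb, hibc⟩ := hone hbc hab.symm hac.symm
    obtain ⟨hc, hica⟩ := hone hac.symm hbc.symm hab
    have h1 := card_union_add_card_inter (H.neighborFinset a) (H.neighborFinset b)
    have h2 := card_union_add_card_inter (H.neighborFinset a ∪ H.neighborFinset b)
      (H.neighborFinset c)
    have h3 : (H.neighborFinset a ∪ H.neighborFinset b) ∩ H.neighborFinset c ⊆ {a, b} := by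
      rw [union_inter_distrib_right, hibc, inter_comm, hica]
      intro z
      simp only [mem_union, mem_singleton, mem_insert]
      tauto
    have h4 := (card_le_card h3).trans card_le_two
    have h5 := card_le_univ (H.neighborFinset a ∪ H.neighborFinset b ∪ H.neighborFinset c)
    rw [hiab, card_singleton] at h1
    simp only [card_neighborFinset_eq_degree] at h1 h2
    lia
  obtain ⟨w, w', hw⟩ := ne_bot_iff_exists_adj.1 hH
  have hmin (i : α) (hi : H.degree i ≠ 0) : 28 ≤ H.degree i := by
    obtain ⟨j, hj⟩ := (H.degree_pos_iff_exists_adj i).1 (Nat.pos_of_ne_zero hi)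
    exact hlow hj
  have hiso := card_isolated_le hcard ⟨w, (by have := hlow hw; lia)⟩ hmin hpsd
  obtain ⟨P, hP⟩ : ∃ P, P = H.neighborFinset w := ⟨_, rfl⟩
  obtain ⟨n, hn⟩ : ∃ n, n = #P := ⟨_, rfl⟩
  have hnw : H.degree w = n := by rw [hn, hP, card_neighborFinset_eq_degree]
  have hn28 : 28 ≤ n := hnw ▸ hlow hw
  have hn29 : n ≤ 29 := hnw ▸ hdeg w
  have hPw {p : α} : p ∈ P ↔ H.Adj w p := by rw [hP, mem_neighborFinset]
  have hPindep : H.IsIndepSet P := fun p hp q hq _ hpq ↦ htri (hPw.1 hp) (hPw.1 hq) hpq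
  have hwP : w ∉ P := fun h ↦ (hPw.1 h).ne rfl
  have hD0 {p : α} (hp : p ∈ P) : #(P ∩ H.neighborFinset p) = 0 := by
    rw [card_eq_zero, eq_empty_iff_forall_notMem]
    intro q hq
    rw [mem_inter, mem_neighborFinset] at hq
    exact hPindep hp hq.1 hq.2.ne hq.2
  have hDw : #(P ∩ H.neighborFinset w) = n := by rw [← hP, inter_self, hn]
  have hDle (r : α) : #(P ∩ H.neighborFinset r) ≤ n := hn ▸ card_le_card inter_subset_left
  have hdich {r : α} (hr : r ∉ P) (h7 : 7 ≤ #(P ∩ H.neighborFinset r)) :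
      n ≤ #(P ∩ H.neighborFinset r) + 6 := by
    have h1 := card_inter_neighborFinset_dichotomy hpsd hPindep hr
    have h2 := card_inter_add_card_sdiff P (H.neighborFinset r)
    rw [← hn] at h1 h2
    by_contra! h3
    have h4 : 7 ≤ #(P \ H.neighborFinset r) := by lia
    obtain ⟨c, hc⟩ := Nat.exists_eq_add_of_le h7
    obtain ⟨d, hd⟩ := Nat.exists_eq_add_of_le h4
    rw [hc, hd] at h1 h2
    nlinarith [Nat.zero_le (c * d)]
  -- the vertices with almost the same neighbourhood as `w`
  set T : Finset α := {r | r ≠ w ∧ r ∉ P ∧ 7 ≤ #(P ∩ H.neighborFinset r)} with hT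
  have hTcard : 21 ≤ #T := by
    have h1 : n * (57 - n) ≤ ∑ r, #(P ∩ H.neighborFinset r) := by
      rw [sum_card_inter_neighborFinset, hn, ← smul_eq_mul]
      refine card_nsmul_le_sum _ _ _ fun p hp ↦ ?_
      have := hsum (hPw.1 hp)
      rw [univ_inter, card_neighborFinset_eq_degree]
      lia
    have h2 : ∑ r, #(P ∩ H.neighborFinset r) ≤
        ∑ r, ((if r ∈ T then n - 6 else 0) + (if r ∈ ({w} : Finset α) then n - 6 else 0) +
          (if r ∈ Pᶜ then 6 else 0)) := by
      refine sum_le_sum fun r _ ↦ ?_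
      have := hDle r
      by_cases hrP : r ∈ P
      · simp [hD0 hrP]
      · by_cases hrw : r = w
        · simp [hrw, hwP]
          lia
        · by_cases h7 : 7 ≤ #(P ∩ H.neighborFinset r)
          · simp [hT, hrP, hrw, h7]
            lia
          · simp [hT, hrP, hrw, h7]
            lia
    simp only [sum_add_distrib, sum_ite_mem, univ_inter, sum_const, smul_eq_mul, card_singleton,
      card_compl, hcard, ← hn] at h2
    interval_cases n <;> lia
  obtain ⟨K, hKT, hK⟩ := exists_subset_card_eq hTcard
  have hKmem {r : α} (hr : r ∈ K) : r ≠ w ∧ r ∉ P ∧ 7 ≤ #(P ∩ H.neighborFinset r) := by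
    simpa [hT] using hKT hr
  have hwK : w ∉ K := fun h ↦ (hKmem h).1 rfl
  set L := insert w K with hL
  have hLcard : #L = 22 := by rw [hL, card_insert_of_notMem hwK, hK]
  have hPL : Disjoint P L := by
    rw [hL, disjoint_insert_right]
    exact ⟨hwP, disjoint_right.2 fun r hr ↦ (hKmem hr).2.1⟩
  have hLP : n + 21 * (n - 6) ≤ ∑ r ∈ L, #(P ∩ H.neighborFinset r) := by
    rw [hL, sum_insert hwK, hDw, ← hK, ← smul_eq_mul]
    gcongr
    refine card_nsmul_le_sum _ _ _ fun r hr ↦ ?_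
    have := hdich (hKmem hr).2.1 (hKmem hr).2.2
    lia
  have hX : 2 * (n + 21 * (n - 6)) ≤ ∑ r ∈ P ∪ L, #((P ∪ L) ∩ H.neighborFinset r) := by
    rw [sum_union hPL, two_mul]
    refine add_le_add (hLP.trans ?_) (hLP.trans ?_)
    · rw [sum_card_inter_neighborFinset]
      gcongr
      exact subset_union_right
    · gcongr
      exact subset_union_left
  have hXcard : #(P ∪ L) = n + 22 := by rw [card_union_of_disjoint hPL, ← hn, hLcard]
  have hXdeg : ∑ r ∈ P ∪ L, H.degree r ≤ (n + 22) * 29 := by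
    rw [← hXcard, ← smul_eq_mul]
    exact sum_le_card_nsmul _ _ _ fun r _ ↦ hdeg r
  have htot : 78 * 28 ≤ ∑ r, H.degree r := by
    have h1 : ∑ r, (if H.degree r = 0 then 0 else 28) ≤ ∑ r, H.degree r := by
      refine sum_le_sum fun r _ ↦ ?_
      split_ifs with hr
      · exact Nat.zero_le _
      · exact hmin r hr
    have h2 := card_filter_add_card_filter_not (s := (univ : Finset α)) (fun r ↦ H.degree r = 0)
    rw [card_univ, hcard] at h2
    simp only [sum_ite, sum_const_zero, sum_const, smul_eq_mul] at h1
    lia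
  have hfin := eleven_mul_sum_degree_le hpsd (P ∪ L)
  rw [hXcard, hcard] at hfin
  have hX' : (2 * (n + 21 * (n - 6) : ℕ) : ℝ) ≤
      ∑ r ∈ P ∪ L, (#((P ∪ L) ∩ H.neighborFinset r) : ℝ) := by exact_mod_cast hX
  have hXdeg' : ∑ r ∈ P ∪ L, (H.degree r : ℝ) ≤ (n + 22) * 29 := by exact_mod_cast hXdeg
  have htot' : (78 * 28 : ℝ) ≤ ∑ r, (H.degree r : ℝ) := by exact_mod_cast htot
  have hn' : n = 28 ∨ n = 29 := by lia
  rcases hn' with h | h <;> rw [h] at hX' hXdeg' hfin <;> norm_num at hX' hXdeg' hfin <;> linarith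

variable {V : Type*} [Fintype V] [DecidableEq V] {G : SimpleGraph V} [DecidableRel G.Adj]

/-- `A + 3I - J/7` is positive semidefinite for the adjacency matrix `A` of `G`. -/
theorem IsSRGWith.sq_sum_le (h : G.IsSRGWith 1911 270 105 27) (f : V → ℝ) :
    (∑ i, f i) ^ 2 ≤ 7 * ∑ i, f i * (3 * f i + ∑ j ∈ G.neighborFinset i, f j) := by
  set A := G.adjMatrix ℝ with hA
  have hAf (g : V → ℝ) (i : V) : (A.mulVec g) i = ∑ j ∈ G.neighborFinset i, g j := by
    simp [hA]
  have hsum (g : V → ℝ) : ∑ i, (A.mulVec g) i = 270 * ∑ i, g i := by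
    simp only [hAf, mul_sum, neighborFinset_eq_filter, sum_filter]
    rw [sum_comm]
    refine sum_congr rfl fun j _ ↦ ?_
    simp_rw [G.adj_comm]
    rw [← sum_filter, ← neighborFinset_eq_filter, sum_const, card_neighborFinset_eq_degree,
      h.regular j]
    simp
  have hsq (i : V) : (A.mulVec (A.mulVec f)) i =
      243 * f i + 78 * (A.mulVec f) i + 27 * ∑ j, f j := by
    have hent (j : V) : (A ^ 2) i j = 243 * (1 : Matrix V V ℝ) i j + 78 * A i j + 27 := by
      rw [hA, h.matrix_eq]
      simp only [Matrix.add_apply, Matrix.smul_apply, adjMatrix_apply, compl_adj,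
        Matrix.one_apply]
      by_cases hij : i = j
      · subst hij
        norm_num
      · by_cases ha : G.Adj i j <;> norm_num [hij, ha]
    rw [Matrix.mulVec_mulVec, ← pow_two]
    conv_rhs => rw [← Matrix.one_mulVec f]
    simp only [Matrix.mulVec, dotProduct, hent, add_mul, sum_add_distrib, mul_sum, mul_assoc]
    simp [Matrix.one_apply]
  have hsym (g k : V → ℝ) : ∑ i, (A.mulVec g) i * k i = ∑ i, g i * (A.mulVec k) i := by
    have := Matrix.dotProduct_mulVec g A k
    rw [← Matrix.mulVec_transpose, hA, transpose_adjMatrix] at this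
    exact this.symm
  have hnorm : ∑ i, (3 * f i + (A.mulVec f) i) ^ 2 =
      84 * ∑ i, f i * (3 * f i + (A.mulVec f) i) + 27 * (∑ i, f i) ^ 2 := by
    have h1 := hsym f (A.mulVec f)
    simp only [hsq] at h1
    have h2 : ∑ i, (3 * f i + (A.mulVec f) i) ^ 2 = ∑ i, f i * (9 * f i + 6 * (A.mulVec f) i) +
        ∑ i, (A.mulVec f) i * (A.mulVec f) i := by
      rw [← sum_add_distrib]
      exact sum_congr rfl fun _ _ ↦ by ring
    rw [h2, h1]
    generalize hS : ∑ i, f i = S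
    have h3 : 27 * S ^ 2 = ∑ i, f i * (27 * S) := by
      rw [← sum_mul, hS]
      ring
    rw [h3, mul_sum, ← sum_add_distrib, ← sum_add_distrib]
    exact sum_congr rfl fun _ _ ↦ by ring
  have hcs := sq_sum_le_card_mul_sum_sq (s := univ) (f := fun i ↦ 3 * f i + (A.mulVec f) i)
  rw [hnorm, sum_add_distrib, hsum, ← mul_sum, card_univ, h.card] at hcs
  simp only [hAf] at hcs
  push_cast at hcs
  linarith

theorem card_inter_neighborFinset_eq_card_commonNeighbors (a b : V) :
    #(G.neighborFinset a ∩ G.neighborFinset b) = Fintype.card (G.commonNeighbors a b) := by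
  rw [← Set.toFinset_card]
  congr 1
  ext
  simp [mem_commonNeighbors]

theorem IsSRGWith.card_inter_of_adj {n k l m : ℕ} (h : G.IsSRGWith n k l m) {a b : V}
    (hab : G.Adj a b) : #(G.neighborFinset a ∩ G.neighborFinset b) = l := by
  rw [card_inter_neighborFinset_eq_card_commonNeighbors, h.of_adj a b hab]

theorem IsSRGWith.card_inter_of_not_adj {n k l m : ℕ} (h : G.IsSRGWith n k l m) {a b : V}
    (hne : a ≠ b) (hab : ¬ G.Adj a b) : #(G.neighborFinset a ∩ G.neighborFinset b) = m := by
  rw [card_inter_neighborFinset_eq_card_commonNeighbors, h.of_not_adj hne hab]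

/-- A vertex outside a clique cannot have many neighbours and many non-neighbours in it. -/
theorem IsSRGWith.card_sdiff_lt (h : G.IsSRGWith 1911 270 105 27) {C : Finset V}
    (hC : G.IsClique C) {p : V} (hp : p ∉ C) (h7 : 7 ≤ #(C ∩ G.neighborFinset p)) :
    #(C \ G.neighborFinset p) < 57 := by
  by_contra! h57
  obtain ⟨S, hS, hS7⟩ := exists_subset_card_eq h7
  obtain ⟨T, hT, hT57⟩ := exists_subset_card_eq h57
  have hSmem {i : V} (hi : i ∈ S) : i ∈ C ∧ G.Adj p i := by simpa using hS hi
  have hTmem {i : V} (hi : i ∈ T) : i ∈ C ∧ ¬ G.Adj p i := by simpa using hT hi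
  have hpS : p ∉ S := fun hi ↦ hp (hSmem hi).1
  have hpT : p ∉ T := fun hi ↦ hp (hTmem hi).1
  set f : V → ℝ := fun i ↦ (if i ∈ S then 57 else 0) + (if i ∈ T then -7 else 0) +
    if i = p then -133 else 0 with hf
  have hsum (s : Finset V) : ∑ i ∈ s, f i =
      57 * #(s ∩ S) - 7 * #(s ∩ T) - if p ∈ s then 133 else 0 := by
    simp only [hf, sum_add_distrib, sum_ite_mem, sum_ite_eq', sum_const, nsmul_eq_mul]
    split_ifs <;> ring
  have hsum_mul (g : V → ℝ) :
      ∑ i, f i * g i = 57 * ∑ i ∈ S, g i - 7 * ∑ i ∈ T, g i - 133 * g p := by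
    simp only [hf, add_mul, ite_mul, zero_mul, sum_add_distrib, sum_ite_mem, sum_ite_eq',
      univ_inter, mul_sum, mem_univ, if_true, neg_mul, sum_neg_distrib]
    ring
  have hnbr {i : V} (hi : i ∈ C) {R : Finset V} (hR : ∀ j ∈ R, j ∈ C) :
      G.neighborFinset i ∩ R = R.erase i := by
    ext j
    simp only [mem_inter, mem_neighborFinset, mem_erase]
    exact ⟨fun h ↦ ⟨h.1.ne', h.2⟩, fun h ↦ ⟨hC hi (hR j h.2) h.1.symm, h.2⟩⟩
  have hSC (j) (hj : j ∈ S) : j ∈ C := (hSmem hj).1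
  have hTC (j) (hj : j ∈ T) : j ∈ C := (hTmem hj).1
  have hS' : ∑ i ∈ S, (3 * f i + ∑ j ∈ G.neighborFinset i, f j) = 7 * (-19) := by
    have : ∀ i ∈ S, 3 * f i + ∑ j ∈ G.neighborFinset i, f j = -19 := fun i hi ↦ by
      have hiT : i ∉ T := fun hi' ↦ (hTmem hi').2 (hSmem hi).2
      have hip : i ≠ p := fun hip ↦ hpS (hip ▸ hi)
      rw [hsum, hnbr (hSC i hi) hSC, hnbr (hSC i hi) hTC, card_erase_of_mem hi,
        erase_eq_of_notMem hiT, hS7, hT57]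
      simp only [hf, hi, hiT, hip, mem_neighborFinset, (hSmem hi).2.symm]
      norm_num
    rw [sum_congr rfl this, sum_const, hS7]
    norm_num
  have hT' : ∑ i ∈ T, (3 * f i + ∑ j ∈ G.neighborFinset i, f j) = 57 * (-14) := by
    have : ∀ i ∈ T, 3 * f i + ∑ j ∈ G.neighborFinset i, f j = -14 := fun i hi ↦ by
      have hiS : i ∉ S := fun hi' ↦ (hTmem hi).2 (hSmem hi').2
      have hip : i ≠ p := fun hip ↦ hpT (hip ▸ hi)
      have hadj : ¬ G.Adj i p := fun h ↦ (hTmem hi).2 h.symm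
      rw [hsum, hnbr (hTC i hi) hSC, hnbr (hTC i hi) hTC, card_erase_of_mem hi,
        erase_eq_of_notMem hiS, hS7, hT57]
      simp only [hf, hi, hiS, hip, mem_neighborFinset, hadj]
      norm_num
    rw [sum_congr rfl this, sum_const, hT57]
    norm_num
  have hp' : 3 * f p + ∑ j ∈ G.neighborFinset p, f j = 0 := by
    have h1 : G.neighborFinset p ∩ S = S :=
      inter_eq_right.2 fun j hj ↦ by simpa using (hSmem hj).2
    have h2 : G.neighborFinset p ∩ T = ∅ := by
      ext j
      simp only [mem_inter, mem_neighborFinset, notMem_empty, iff_false]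
      exact fun h ↦ (hTmem h.2).2 h.1
    rw [hsum, h1, h2, hS7]
    simp only [hf, hpS, hpT]
    norm_num
  have h1 := h.sq_sum_le f
  rw [hsum_mul, hS', hT', hp'] at h1
  nlinarith [sq_nonneg (∑ i, f i)]

/-- Counting edges that leave a maximal clique. -/
theorem IsSRGWith.card_clique_le (h : G.IsSRGWith 1911 270 105 27) {K : Finset V}
    (hK : G.IsClique K) : #K ≤ 83 := by
  by_contra! hK84
  obtain ⟨C, hKC, hC⟩ :=
    Finite.exists_le_maximal (p := fun s : Finset V ↦ G.IsClique (s : Set V)) hK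
  have hn84 : 84 ≤ #C := hK84.trans_le (card_le_card hKC) |> Nat.succ_le_of_lt
  have hclique : G.IsClique (C : Set V) := hC.prop
  have hn107 : #C ≤ 107 := by
    obtain ⟨a, ha, b, hb, hab⟩ := one_lt_card.1 (by lia : 1 < #C)
    have h1 : (C.erase a).erase b ⊆ G.neighborFinset a ∩ G.neighborFinset b := fun z hz ↦ by
      simp only [mem_erase] at hz
      simp only [mem_inter, mem_neighborFinset]
      exact ⟨hclique ha hz.2.2 hz.2.1.symm, hclique hb hz.2.2 hz.1.symm⟩
    have h2 := card_le_card h1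
    rw [h.card_inter_of_adj (hclique ha hb hab),
      card_erase_of_mem (mem_erase.2 ⟨hab.symm, hb⟩), card_erase_of_mem ha] at h2
    lia
  have hout {p : V} (hp : p ∉ C) : #(C ∩ G.neighborFinset p) ≤ 6 := by
    obtain ⟨c, hc, hpc⟩ : ∃ c ∈ C, ¬ G.Adj p c := by
      by_contra! hall
      refine hp (hC.le_of_ge (y := insert p C) ?_ (subset_insert p C) (mem_insert_self p C))
      rw [coe_insert]
      exact hclique.insert fun b hb _ ↦ hall b hb
    have hne : p ≠ c := fun h ↦ hp (h ▸ hc)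
    have h1 : C ∩ G.neighborFinset p ⊆ G.neighborFinset p ∩ G.neighborFinset c := fun z hz ↦ by
      simp only [mem_inter, mem_neighborFinset] at hz ⊢
      exact ⟨hz.2, hclique hc hz.1 fun h ↦ hpc (h ▸ hz.2)⟩
    have h2 := card_le_card h1
    rw [h.card_inter_of_not_adj hne hpc] at h2
    have h3 := card_inter_add_card_sdiff C (G.neighborFinset p)
    by_contra! h7
    have := h.card_sdiff_lt hclique hp h7
    lia
  have hle : ∑ p ∈ Cᶜ, #(C ∩ G.neighborFinset p) ≤ (1911 - #C) * 6 := by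
    rw [← h.card, ← card_compl, ← smul_eq_mul]
    exact sum_le_card_nsmul _ _ _ fun p hp ↦ hout (mem_compl.1 hp)
  have hge : ∑ p ∈ Cᶜ, #(C ∩ G.neighborFinset p) = #C * (271 - #C) := by
    rw [sum_card_inter_neighborFinset, ← smul_eq_mul, ← sum_const]
    refine sum_congr rfl fun c hc ↦ ?_
    have h1 : C ∩ G.neighborFinset c = C.erase c := by
      ext z
      simp only [mem_inter, mem_neighborFinset, mem_erase]
      exact ⟨fun h ↦ ⟨h.2.ne', h.1⟩, fun h ↦ ⟨h.2, hclique hc h.2 h.1.symm⟩⟩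
    have h2 := card_inter_add_card_sdiff (G.neighborFinset c) C
    rw [inter_comm, h1, card_erase_of_mem hc, card_neighborFinset_eq_degree, h.regular c,
      sdiff_eq_inter_compl, inter_comm] at h2
    lia
  rw [hge] at hle
  obtain ⟨a, ha⟩ := Nat.exists_eq_add_of_le hn84
  obtain ⟨b, hb⟩ := Nat.exists_eq_add_of_le hn107
  have h1 : 271 - #C = 164 + b := by lia
  rw [h1] at hle
  have h2 : #C * (164 + b) ≥ 84 * 164 := Nat.mul_le_mul hn84 (by lia)
  lia

/-- The semidefiniteness of `A + 3I - J/7`, restricted to neighbours of `x` that are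
not adjacent to two non-adjacent neighbours `u`, `v` of `x`. -/
theorem IsSRGWith.six_mul_sq_sum_le (h : G.IsSRGWith 1911 270 105 27) {x u v : V}
    (hxu : G.Adj x u) (hxv : G.Adj x v) (huv : ¬ G.Adj u v) (huv' : u ≠ v) {W : Finset V}
    (hW : ∀ w ∈ W, G.Adj x w ∧ w ≠ u ∧ w ≠ v ∧ ¬ G.Adj u w ∧ ¬ G.Adj v w) (g : V → ℝ) :
    6 * (∑ i ∈ W, g i) ^ 2 ≤ 33 * ∑ i ∈ W, g i ^ 2 +
      11 * ∑ i ∈ W, g i * ∑ j ∈ G.neighborFinset i ∩ W, g j := by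
  obtain ⟨t, ht⟩ : ∃ t, t = ∑ i ∈ W, g i := ⟨_, rfl⟩
  have hxW : x ∉ W := fun hw ↦ (hW x hw).1.ne rfl
  have huW : u ∉ W := fun hw ↦ (hW u hw).2.1 rfl
  have hvW : v ∉ W := fun hw ↦ (hW v hw).2.2.1 rfl
  set f : V → ℝ := fun i ↦ 22 * (if i ∈ W then g i else 0) + (if i = x then -9 * t else 0) +
    (if i = u then 4 * t else 0) + (if i = v then 4 * t else 0) with hf
  have hsum (s : Finset V) : ∑ i ∈ s, f i = 22 * ∑ i ∈ s ∩ W, g i +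
      (if x ∈ s then -9 * t else 0) + (if u ∈ s then 4 * t else 0) +
      (if v ∈ s then 4 * t else 0) := by
    simp only [hf, sum_add_distrib, ← mul_sum, sum_ite_mem, sum_ite_eq']
  have hsum_mul (k : V → ℝ) : ∑ i, f i * k i =
      22 * ∑ i ∈ W, g i * k i - 9 * t * k x + 4 * t * k u + 4 * t * k v := by
    simp only [hf, add_mul, ite_mul, mul_assoc, zero_mul, sum_add_distrib, ← mul_sum, sum_ite_mem,
      sum_ite_eq', univ_inter, mem_univ, if_true]
    ring
  have hfW : ∀ i ∈ W, 3 * f i + ∑ j ∈ G.neighborFinset i, f j =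
      66 * g i + 22 * ∑ j ∈ G.neighborFinset i ∩ W, g j - 9 * t := fun i hi ↦ by
    obtain ⟨h1, h2, h3, h4, h5⟩ := hW i hi
    rw [G.adj_comm] at h4 h5
    rw [hsum]
    simp only [hf, mem_neighborFinset, hi, h1.ne', h2, h3, h1.symm, h4, h5,
      if_true, if_false]
    ring
  have hNx : G.neighborFinset x ∩ W = W :=
    inter_eq_right.2 fun i hi ↦ by simpa using (hW i hi).1
  have hNu : G.neighborFinset u ∩ W = ∅ := by
    ext i
    simp only [mem_inter, mem_neighborFinset, notMem_empty, iff_false]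
    exact fun hi ↦ (hW i hi.2).2.2.2.1 hi.1
  have hNv : G.neighborFinset v ∩ W = ∅ := by
    ext i
    simp only [mem_inter, mem_neighborFinset, notMem_empty, iff_false]
    exact fun hi ↦ (hW i hi.2).2.2.2.2 hi.1
  have hfx : 3 * f x + ∑ j ∈ G.neighborFinset x, f j = 3 * t := by
    rw [hsum, hNx, ← ht]
    simp only [hf, mem_neighborFinset, hxW, hxu, hxv, hxu.ne, hxv.ne, SimpleGraph.irrefl,
      if_true, if_false]
    ring
  have hfu : 3 * f u + ∑ j ∈ G.neighborFinset u, f j = 3 * t := by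
    rw [hsum, hNu]
    simp only [hf, mem_neighborFinset, huW, hxu.symm, hxu.ne', huv, huv', SimpleGraph.irrefl,
      if_true, if_false, sum_empty]
    ring
  have hvu : ¬ G.Adj v u := fun h ↦ huv h.symm
  have hfv : 3 * f v + ∑ j ∈ G.neighborFinset v, f j = 3 * t := by
    rw [hsum, hNv]
    simp only [hf, mem_neighborFinset, hvW, hxv.symm, hxv.ne', hvu, huv'.symm,
      SimpleGraph.irrefl, if_true, if_false, sum_empty]
    ring
  have h1 := h.sq_sum_le f
  have h2 : ∑ i, f i = 21 * t := by
    rw [hsum, univ_inter, ← ht]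
    simp only [mem_univ, if_true]
    ring
  have h3 : ∑ i ∈ W, g i * (3 * f i + ∑ j ∈ G.neighborFinset i, f j) =
      66 * ∑ i ∈ W, g i ^ 2 + 22 * ∑ i ∈ W, g i * ∑ j ∈ G.neighborFinset i ∩ W, g j -
        9 * t ^ 2 := by
    have h4 : 9 * t ^ 2 = ∑ i ∈ W, g i * (9 * t) := by
      rw [← sum_mul, ← ht]
      ring
    rw [h4, mul_sum, mul_sum, ← sum_add_distrib, ← sum_sub_distrib]
    refine sum_congr rfl fun i hi ↦ ?_
    rw [hfW i hi]
    ring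
  rw [hsum_mul, h3, hfx, hfu, hfv, h2] at h1
  rw [← ht]
  linarith

/-- The neighbours of `x` that are neither equal nor adjacent to two non-adjacent neighbours
`u`, `v` of `x` do not number `83`: they would form a clique together with `x`. -/
theorem IsSRGWith.card_ne_83 (h : G.IsSRGWith 1911 270 105 27)
    {x u v : V} (hxu : G.Adj x u) (hxv : G.Adj x v) (huv : ¬ G.Adj u v) (huv' : u ≠ v)
    {W : Finset V}
    (hW : ∀ w, w ∈ W ↔ G.Adj x w ∧ w ≠ u ∧ w ≠ v ∧ ¬ G.Adj u w ∧ ¬ G.Adj v w) : #W ≠ 83 := by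
  intro hcard
  set H : SimpleGraph W := (G.comap Subtype.val)ᶜ with hH
  have hmem (a b : W) : b ∈ H.neighborFinset a ↔ (b : V) ≠ a ∧ ¬ G.Adj a b := by
    rw [mem_neighborFinset, hH, compl_adj, comap_adj, ne_comm, ne_eq, Subtype.ext_iff]
  have hmap (w : W) :
      (H.neighborFinset w).map (.subtype _) = (W \ G.neighborFinset w).erase w := by
    ext z
    simp only [mem_map, hmem, mem_erase, mem_sdiff, mem_neighborFinset,
      Function.Embedding.coe_subtype]
    constructor
    · rintro ⟨z, hz, rfl⟩
      exact ⟨hz.1, z.2, hz.2⟩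
    · exact fun hz ↦ ⟨⟨z, hz.2.1⟩, ⟨hz.1, hz.2.2⟩, rfl⟩
  have hcodeg {a b : V} (hxa : G.Adj x a) (hxb : G.Adj x b) (hne : a ≠ b) (hab : ¬ G.Adj a b) :
      #((G.neighborFinset a ∩ G.neighborFinset b).erase x) = 26 := by
    rw [card_erase_of_mem (by simp [hxa.symm, hxb.symm]), h.card_inter_of_not_adj hne hab]
  have hbot : H = ⊥ := by
    refine eq_bot_of_card_eq_83 H (by simpa using hcard) (fun w ↦ ?_) (fun a b hab ↦ ?_)
      fun f ↦ ?_
    · obtain ⟨hxw, hwu, hwv, huw, hvw⟩ := (hW w).1 w.2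
      have h2 : G.neighborFinset x ∩ G.neighborFinset w ⊆ (W ∩ G.neighborFinset w) ∪
          ((G.neighborFinset u ∩ G.neighborFinset w).erase x ∪
            (G.neighborFinset v ∩ G.neighborFinset w).erase x) := by
        intro z
        simp only [mem_inter, mem_neighborFinset, mem_union, mem_erase, hW]
        rintro ⟨hxz, hwz⟩
        have hzu : z ≠ u := fun h ↦ huw (h ▸ hwz).symm
        have hzv : z ≠ v := fun h ↦ hvw (h ▸ hwz).symm
        have := hxz.ne'
        tauto
      have h3 := (card_le_card h2).trans ((card_union_le _ _).trans
        (Nat.add_le_add_left (card_union_le _ _) _))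
      rw [h.card_inter_of_adj hxw, hcodeg hxu hxw hwu.symm huw, hcodeg hxv hxw hwv.symm hvw] at h3
      have h4 := card_inter_add_card_sdiff W (G.neighborFinset w)
      rw [← card_neighborFinset_eq_degree, ← card_map (.subtype _), hmap,
        card_erase_of_mem (by simp)]
      lia
    · have hab' : (b : V) ≠ a ∧ ¬ G.Adj a b := (hmem a b).1 ((mem_neighborFinset _ _ _).2 hab)
      have h1 : ((H.neighborFinset a ∪ H.neighborFinset b)ᶜ).map (.subtype _) ⊆
          (G.neighborFinset a ∩ G.neighborFinset b).erase x := by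
        intro z hz
        obtain ⟨c, hc, rfl⟩ := mem_map.1 hz
        have hxc := ((hW c).1 c.2).1.ne'
        rw [mem_compl, mem_union, hmem, hmem] at hc
        simp only [Function.Embedding.coe_subtype, mem_inter, mem_neighborFinset, mem_erase]
        have hca : (c : V) ≠ a := fun h ↦ by
          have := G.adj_comm a b
          rw [h] at hc
          tauto
        have hcb : (c : V) ≠ b := fun h ↦ by
          rw [h] at hc
          tauto
        tauto
      have h2 := card_le_card h1
      rw [card_map, hcodeg ((hW a).1 a.2).1 ((hW b).1 b.2).1 hab'.1.symm hab'.2, card_compl,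
        Fintype.card_coe, hcard] at h2
      lia
    · set g : V → ℝ := fun z ↦ if hz : z ∈ W then f ⟨z, hz⟩ else 0 with hg
      have hgf (i : W) : g i = f i := by simp [hg]
      have h1 := h.six_mul_sq_sum_le hxu hxv huv huv' (fun w hw ↦ (hW w).1 hw) g
      have h2 (i : W) : ∑ j ∈ H.neighborFinset i, f j =
          ∑ j ∈ W, g j - g i - ∑ j ∈ G.neighborFinset i ∩ W, g j := by
        have h3 : ∑ j ∈ H.neighborFinset i, f j =
            ∑ j ∈ (H.neighborFinset i).map (.subtype _), g j := by
          simp only [sum_map, Function.Embedding.coe_subtype, hgf]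
        rw [h3, hmap, sum_erase_eq_sub (by simp), inter_comm,
          ← sum_inter_add_sum_sdiff W (G.neighborFinset i)]
        ring
      simp only [← sum_coe_sort W, hgf] at h1 h2
      simp only [h2, mul_sub, sum_sub_distrib, ← sum_mul, ← pow_two]
      linarith
  have hclique : G.IsClique (insert x W : Finset V) := by
    rw [coe_insert]
    refine IsClique.insert (fun a ha b hb hab ↦ ?_) fun b hb _ ↦ ((hW b).1 hb).1
    by_contra hnadj
    have : H.Adj ⟨a, ha⟩ ⟨b, hb⟩ := by
      rw [← mem_neighborFinset, hmem]
      exact ⟨hab.symm, hnadj⟩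
    rw [hbot] at this
    exact this
  have := h.card_clique_le hclique
  rw [card_insert_of_notMem fun hx ↦ ((hW x).1 hx).1.ne rfl, hcard] at this
  lia

end SimpleGraph

end

/-- Let `G` be a strongly regular graph with parameters `(1911, 270, 105, 27)` with an
induced quadrangle `x ~ u ~ y ~ v ~ x`, and let
`W = {w : w ~ x, w ∉ {u,v}, w ≁ u, w ≁ v}`. Then `|W| ≠ 83`. -/
theorem srg_1911_W_card_ne_83 {V : Type*} [Fintype V] [DecidableEq V]
    (G : SimpleGraph V) [DecidableRel G.Adj] (h : G.IsSRGWith 1911 270 105 27)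
    (x u y v : V)
    (hd : x ≠ u ∧ x ≠ y ∧ x ≠ v ∧ u ≠ y ∧ u ≠ v ∧ y ≠ v)
    (hxu : G.Adj x u) (huy : G.Adj u y) (hyv : G.Adj y v) (hvx : G.Adj v x)
    (hxy : ¬ G.Adj x y) (huv : ¬ G.Adj u v)
    (W : Finset V)
    (hW : W = Finset.univ.filter fun w =>
      G.Adj x w ∧ w ≠ u ∧ w ≠ v ∧ ¬ G.Adj u w ∧ ¬ G.Adj v w) :
    W.card ≠ 83 := by
  subst hW
  exact h.card_ne_83 hxu hvx.symm huv hd.2.2.2.2.1 (by simp)
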